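/- Let p_1 = 2, p_2 = 3, … denote the prime numbers in increasing order. For every integer S ≥ 9, the sum of the first S primes satisfies ∑_{i=1}^{S} p_i ≤ 0.564·S²·log S. -/

import Mathlib

/-- `f n`, arranged so that the kernel evaluates `n` to a literal first. -/
def force (n : ℕ) (f : ℕ → Bool) : Bool :=
  Nat.rec (motive := fun _ => Bool) (f 0) (fun m _ => f (Nat.succ m)) n

lemma force_eq (n : ℕ) (f : ℕ → Bool) : force n f = f n := by
  cases n <;> rfl

/-- Increase `e` towards the binary logarithm of `X`, by at most `k`. -/
def climb (X : ℕ) (f : ℕ → Bool) (k : ℕ) : ℕ → Bool :=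
  Nat.rec (motive := fun _ => ℕ → Bool) f
    (fun _ ih e => force (Nat.succ e) fun e' => cond (Nat.ble (Nat.pow 2 e') X) (ih e') (f e)) k

lemma exists_of_climb {X : ℕ} {f : ℕ → Bool} (k : ℕ) :
    ∀ {e : ℕ}, climb X f k e = true → ∃ e', f e' = true := by
  induction k with
  | zero => exact fun h => ⟨_, h⟩
  | succ k ih =>
    intro e h
    have h : force (Nat.succ e) (fun e' => cond (Nat.ble (Nat.pow 2 e') X)
      (climb X f k e') (f e)) = true := h
    rw [force_eq] at h
    rcases hb : Nat.ble (Nat.pow 2 (Nat.succ e)) X <;> rw [hb] at h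
    exacts [⟨_, h⟩, ih h]

/-- The step of `primeScan` at a prime `n`, passing on the new state. -/
def primeStep (n S s a e e' : ℕ) (f : ℕ → ℕ → ℕ → ℕ → ℕ → Bool) : Bool :=
  force (Nat.succ S) fun S => force (Nat.add s n) fun s =>
    force (Nat.pow n 256) fun X => climb X (fun e =>
      cond (Nat.ble X (Nat.pow 2 (Nat.succ e)))
        (force (Nat.pow S 256) fun Y => climb Y (fun e' =>
          cond (Nat.ble (Nat.pow 2 e') Y)
            (cond (Nat.ble (Nat.mul 256000000000 s)
                (Nat.mul 564 (Nat.mul (Nat.mul S S) (Nat.mul e' 693147))))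
              (force (Nat.add a (Nat.succ e)) fun a => f S s a e e') false) false) 200 e')
        false) 200 e

/-- Run through `m` consecutive integers from `n` on, recognising primes as the integers coprime
to `P`. Here `S` counts the primes below `n`, `s` is their sum, `a` bounds `256` times the sum of
their binary logarithms, and `e`, `e'` approximate `256` times the binary logarithms of the last
prime and of `S`. -/
def primeScan (P : ℕ) (fin : ℕ → ℕ → ℕ → ℕ → ℕ → Bool) (m : ℕ) :
    ℕ → ℕ → ℕ → ℕ → ℕ → ℕ → Bool :=
  Nat.rec (motive := fun _ => ℕ → ℕ → ℕ → ℕ → ℕ → ℕ → Bool)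
    (fun _ S s a e e' => fin S s a e e')
    (fun _ ih n S s a e e' => force (Nat.succ n) fun n' =>
      cond (Nat.beq (Nat.gcd n P) 1)
        (primeStep n S s a e e' (ih n'))
        (ih n' S s a e e')) m

lemma primeScan_succ (P : ℕ) (fin : ℕ → ℕ → ℕ → ℕ → ℕ → Bool) (m n S s a e e' : ℕ) :
    primeScan P fin (m + 1) n S s a e e' =
      cond (Nat.beq (Nat.gcd n P) 1) (primeStep n S s a e e' (primeScan P fin m (n + 1)))
        (primeScan P fin m (n + 1) S s a e e') := rfl

/-- What is known in a state of `primeScan`, including the desired bound so far. -/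
structure PrimeScanInv (n S s a : ℕ) : Prop where
  count : Nat.count Nat.Prime n = S
  sum : ∑ i ∈ Finset.range S, Nat.nth Nat.Prime i = s
  log : ∑ p ∈ (Finset.range n).filter Nat.Prime, Real.log p ≤ a / 256 * Real.log 2
  bound : ∀ T : ℕ, 9 ≤ T → T ≤ S →
    ∑ i ∈ Finset.range T, (Nat.nth Nat.Prime i : ℝ) ≤ 0.564 * (T : ℝ) ^ 2 * Real.log T

lemma prime_iff_gcd_factorial {k n : ℕ} (h1 : k < n) (h2 : n < (k + 1) ^ 2) (hn : 1 < n) :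
    n.Prime ↔ Nat.gcd n (Nat.factorial k) = 1 := by
  constructor
  · intro hp
    exact hp.coprime_factorial_of_lt h1
  · intro hg
    rw [Nat.prime_def_le_sqrt]
    refine ⟨hn, fun m hm hms hd => ?_⟩
    have hmk : m ≤ k := by
      have : Nat.sqrt n < k + 1 := Nat.sqrt_lt'.2 h2
      omega
    have : m ∣ Nat.gcd n (Nat.factorial k) :=
      Nat.dvd_gcd hd (Nat.dvd_factorial (by omega) hmk)
    rw [hg] at this
    have := Nat.le_of_dvd one_pos this
    omega

lemma sum_bound_of_pow_le {S s e : ℕ} (hS : 1 ≤ S) (h1 : 2 ^ e ≤ S ^ 256)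
    (h2 : 256000000000 * s ≤ 564 * (S * S * (e * 693147))) :
    (s : ℝ) ≤ 0.564 * (S : ℝ) ^ 2 * Real.log S := by
  have h3 : (e : ℝ) * Real.log 2 ≤ 256 * Real.log S := by
    have : ((2 : ℝ) ^ e) ≤ (S : ℝ) ^ 256 := by exact_mod_cast h1
    have := Real.log_le_log (by positivity) this
    simpa using this
  have h4 : (256000000000 * s : ℝ) ≤ 564 * (S * S * (e * 693147)) := by exact_mod_cast h2
  have h5 := Real.log_two_gt_d9
  have h6 : (e : ℝ) * 0.693147 ≤ 256 * Real.log S := by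
    refine le_trans ?_ h3
    gcongr
    linarith
  have h7 : (S : ℝ) ^ 2 * (e * 0.693147) ≤ (S : ℝ) ^ 2 * (256 * Real.log S) := by gcongr
  nlinarith

lemma PrimeScanInv.of_primeScan {k P : ℕ} (hk : 1 ≤ k) (hP : P = Nat.factorial k)
    {fin : ℕ → ℕ → ℕ → ℕ → ℕ → Bool} (m : ℕ) :
    ∀ {n S s a e e' : ℕ}, k < n → n + m ≤ (k + 1) ^ 2 → PrimeScanInv n S s a →
    primeScan P fin m n S s a e e' = true →
    ∃ S' s' a' f f', PrimeScanInv (n + m) S' s' a' ∧ fin S' s' a' f f' = true := by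
  induction m with
  | zero => intro n S s a e e' _ _ hI h; exact ⟨_, _, _, _, _, hI, h⟩
  | succ m ih =>
    intro n S s a e e' hn hm hI h
    have hnm : n + (m + 1) = (n + 1) + m := by ring
    rw [hnm]
    have hpr := prime_iff_gcd_factorial hn (by omega) (by omega)
    rw [← hP] at hpr
    rw [primeScan_succ] at h
    by_cases hp : n.Prime
    · rw [hpr.1 hp, Nat.beq_refl, cond_true, primeStep] at h
      simp only [force_eq] at h
      obtain ⟨e, h⟩ := exists_of_climb _ h
      simp only [Bool.cond_false_right, Bool.and_eq_true, Nat.ble_eq] at h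
      obtain ⟨hX, h⟩ := h
      obtain ⟨e', h⟩ := exists_of_climb _ h
      simp only [Bool.and_eq_true, Nat.ble_eq] at h
      obtain ⟨hY, hs, h⟩ := h
      refine ih (by omega) (by omega) ?_ h
      have hnth : Nat.nth Nat.Prime S = n := by rw [← hI.count]; exact Nat.nth_count hp
      have hsum : ∑ i ∈ Finset.range (S + 1), Nat.nth Nat.Prime i = s + n := by
        rw [Finset.sum_range_succ, hI.sum, hnth]
      refine ⟨?_, hsum, ?_, ?_⟩
      · rw [Nat.count_succ, if_pos hp, hI.count]
      · rw [Finset.range_add_one, Finset.filter_insert, if_pos hp, Finset.sum_insert (by simp)]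
        have h1 : (256 : ℝ) * Real.log n ≤ (e + 1 : ℕ) * Real.log 2 := by
          have : (n : ℝ) ^ 256 ≤ (2 : ℝ) ^ (e + 1) := by exact_mod_cast hX
          have := Real.log_le_log (pow_pos (Nat.cast_pos.2 hp.pos) _) this
          rw [Real.log_pow, Real.log_pow] at this
          exact_mod_cast this
        have h2 := hI.log
        have h3 : ((a.add e.succ : ℕ) : ℝ) = a + (e + 1 : ℕ) := by
          rw [← Nat.cast_add]; rfl
        rw [h3]
        linarith
      · intro T hT hTS
        rcases Nat.lt_or_ge T (S + 1) with hlt | hge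
        · exact hI.bound T hT (by omega)
        · obtain rfl : T = S + 1 := le_antisymm hTS hge
          have := sum_bound_of_pow_le (by omega) hY hs
          rw [← Nat.cast_sum, hsum]
          exact this
    · have hb : Nat.beq (Nat.gcd n P) 1 = false := by
        rw [← Bool.not_eq_true]
        exact fun hg => hp (hpr.2 (Nat.eq_of_beq_eq_true hg))
      rw [hb] at h
      refine ih (by omega) (by omega) ⟨?_, hI.sum, ?_, hI.bound⟩ h
      · rw [Nat.count_succ, if_neg hp, hI.count, add_zero]
      · rw [Finset.range_add_one, Finset.filter_insert, if_neg hp]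
        exact hI.log

lemma primeScanInv_24 : PrimeScanInv 24 9 100 7105 := by
  have hc : Nat.count Nat.Prime 24 = 9 := by decide +kernel
  have hs : ∑ i ∈ Finset.range 9, Nat.nth Nat.Prime i = 100 := by
    have h (p : ℕ) (hp : p.Prime) : Nat.nth Nat.Prime (Nat.count Nat.Prime p) = p :=
      Nat.nth_count hp
    have h0 := h 2 (by norm_num)
    have h1 := h 3 (by norm_num)
    have h2 := h 5 (by norm_num)
    have h3 := h 7 (by norm_num)
    have h4 := h 11 (by norm_num)
    have h5 := h 13 (by norm_num)
    have h6 := h 17 (by norm_num)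
    have h7 := h 19 (by norm_num)
    have h8 := h 23 (by norm_num)
    rw [show Nat.count Nat.Prime 2 = 0 by decide +kernel] at h0
    rw [show Nat.count Nat.Prime 3 = 1 by decide +kernel] at h1
    rw [show Nat.count Nat.Prime 5 = 2 by decide +kernel] at h2
    rw [show Nat.count Nat.Prime 7 = 3 by decide +kernel] at h3
    rw [show Nat.count Nat.Prime 11 = 4 by decide +kernel] at h4
    rw [show Nat.count Nat.Prime 13 = 5 by decide +kernel] at h5
    rw [show Nat.count Nat.Prime 17 = 6 by decide +kernel] at h6
    rw [show Nat.count Nat.Prime 19 = 7 by decide +kernel] at h7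
    rw [show Nat.count Nat.Prime 23 = 8 by decide +kernel] at h8
    simp only [Finset.sum_range_succ, Finset.sum_range_zero, h0, h1, h2, h3, h4, h5, h6, h7, h8]
  refine ⟨hc, hs, ?_, ?_⟩
  · have hf : (Finset.range 24).filter Nat.Prime = {2, 3, 5, 7, 11, 13, 17, 19, 23} := by
      decide +kernel
    have hl : ∑ p ∈ (Finset.range 24).filter Nat.Prime, Real.log p = Real.log 223092870 := by
      rw [← Real.log_prod (by rw [hf]; simp), hf]
      norm_num
    have h2 : (256 : ℝ) * Real.log 223092870 ≤ (7105 : ℕ) * Real.log 2 := by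
      have h : (223092870 : ℝ) ^ 256 ≤ 2 ^ 7105 := by
        have : (223092870 : ℕ) ^ 256 ≤ 2 ^ 7105 := by decide +kernel
        exact_mod_cast this
      have := Real.log_le_log (by positivity) h
      simpa using this
    rw [hl]
    push_cast at h2 ⊢
    linarith
  · intro T h1 h2
    obtain rfl : T = 9 := le_antisymm h2 h1
    rw [← Nat.cast_sum, hs]
    exact sum_bound_of_pow_le (e := 811) (by norm_num) (by decide +kernel) (by norm_num)

/-- A state of `primeScan`. -/
structure ScanState where
  S : ℕ
  s : ℕ
  a : ℕ
  e : ℕ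
  e' : ℕ

/-- Comparison of a state of `primeScan` with an expected one. -/
def ScanState.check (t : ScanState) (S s a e e' : ℕ) : Bool :=
  cond (Nat.beq S t.S) (cond (Nat.beq s t.s) (cond (Nat.beq a t.a)
    (cond (Nat.beq e t.e) (Nat.beq e' t.e') false) false) false) false

lemma ScanState.eq_of_check {t : ScanState} {S s a e e' : ℕ} (h : t.check S s a e e' = true) :
    S = t.S ∧ s = t.s ∧ a = t.a ∧ e = t.e ∧ e' = t.e' := by
  simpa [ScanState.check, Nat.beq_eq] using h

/-- Check that `primeScan` passes from each of the given states to the next one in `m` steps. -/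
def scanChain (P m : ℕ) (l : List ScanState) : ℕ → ScanState → Bool :=
  List.rec (motive := fun _ => ℕ → ScanState → Bool) (fun _ _ => true)
    (fun t' _ ih n t => cond (primeScan P t'.check m n t.S t.s t.a t.e t.e')
      (force (Nat.add n m) fun n' => ih n' t') false) l

lemma PrimeScanInv.of_scanChain {k P m : ℕ} (hk : 1 ≤ k) (hP : P = Nat.factorial k)
    (l : List ScanState) : ∀ {n : ℕ} {t : ScanState}, k < n → n + m * l.length ≤ (k + 1) ^ 2 →
    PrimeScanInv n t.S t.s t.a → scanChain P m l n t = true →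
    PrimeScanInv (n + m * l.length) (l.getLastD t).S (l.getLastD t).s (l.getLastD t).a := by
  induction l with
  | nil => exact fun _ _ hI _ => hI
  | cons t' l ih =>
    intro n t hn hm hI h
    have hnm : n + m * (t' :: l).length = (n + m) + m * l.length := by
      rw [List.length_cons]; ring
    have h : cond (primeScan P t'.check m n t.S t.s t.a t.e t.e')
      (force (Nat.add n m) fun n' => scanChain P m l n' t') false = true := h
    rw [Bool.cond_false_right, Bool.and_eq_true, force_eq] at h
    rw [hnm] at hm ⊢
    obtain ⟨S', s', a', e, e', hI', hc⟩ :=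
      PrimeScanInv.of_primeScan hk hP m hn (by omega) hI h.1
    obtain ⟨rfl, rfl, rfl, -, -⟩ := ScanState.eq_of_check hc
    rw [List.getLastD_cons]
    exact ih (by omega) hm hI' h.2

/-- The factorial of `23`, which detects primality below `24 ^ 2`. -/
@[irreducible] def factorial23 : ℕ := Nat.factorial 23

lemma factorial23_eq : factorial23 = Nat.factorial 23 := by
  rw [factorial23]

/-- The factorial of `549`, which detects primality below `550 ^ 2`. -/
@[irreducible] def factorial549 : ℕ := Nat.factorial 549

lemma exists_factorial549_eq : ∃ k, k = 549 ∧ factorial549 = Nat.factorial k := by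
  delta factorial549
  exact ⟨_, rfl, rfl⟩

lemma PrimeScanInv.trans {n n' : ℕ} {t t' : ScanState} {l : List ScanState}
    (hI : PrimeScanInv n t.S t.s t.a)
    (h : force factorial549 (fun P => scanChain P 7364 l n t) = true)
    (hl : n + 7364 * l.length = n') (ht : l.getLastD t = t') (hn : 549 < n) (hn' : n' ≤ 302500) :
    PrimeScanInv n' t'.S t'.s t'.a := by
  subst hl ht
  rw [force_eq] at h
  obtain ⟨k, hk, hP⟩ := exists_factorial549_eq
  exact PrimeScanInv.of_scanChain (by omega) hP l (by omega) (by rw [hk]; omega) hI h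

lemma primeScan_eq_true :
    force factorial23 (fun P => primeScan P (ScanState.check ⟨105, 26940, 198557, 2344, 1718⟩)
      552 24 9 100 7105 1158 811) = true := by
  decide +kernel

lemma primeScanInv_576 : PrimeScanInv 576 105 26940 198557 := by
  have h := primeScan_eq_true
  rw [force_eq] at h
  obtain ⟨S, s, a, e, e', hI, h⟩ := PrimeScanInv.of_primeScan (k := 23) (by norm_num)
    factorial23_eq 552 (by norm_num) (by norm_num) primeScanInv_24 h
  obtain ⟨rfl, rfl, rfl, -, -⟩ := ScanState.eq_of_check h
  exact hI

lemma scanChain_576 : force factorial549 (fun P => scanChain P 7364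
      [⟨1003, 3706710, 2895764, 3316, 2552⟩,
      ⟨1787, 12796398, 5600857, 3558, 2765⟩,
      ⟨2531, 26908548, 8306200, 3703, 2894⟩,
      ⟨3248, 45765917, 11000736, 3807, 2986⟩,
      ⟨3959, 69725628, 13738159, 3888, 3059⟩,
      ⟨4651, 98156298, 16453259, 3955, 3118⟩]
      576 ⟨105, 26940, 198557, 2344, 1718⟩) = true := by
  decide +kernel

lemma primeScanInv_44760 : PrimeScanInv 44760 4651 98156298 16453259 :=
  PrimeScanInv.trans primeScanInv_576 scanChain_576 rfl rfl (by norm_num) (by norm_num)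

lemma scanChain_44760 : force factorial549 (fun P => scanChain P 7364
      [⟨5329, 131023590, 19154945, 4011, 3169⟩,
      ⟨6015, 169340084, 21924456, 4060, 3213⟩,
      ⟨6661, 210160544, 24561969, 4103, 3251⟩,
      ⟨7323, 256851640, 27291707, 4141, 3286⟩,
      ⟨7980, 308043419, 30024990, 4176, 3318⟩,
      ⟨8615, 362159148, 32687789, 4208, 3346⟩]
      44760 ⟨4651, 98156298, 16453259, 3955, 3118⟩) = true := by
  decide +kernel

lemma primeScanInv_88944 : PrimeScanInv 88944 8615 362159148 32687789 :=
  PrimeScanInv.trans primeScanInv_44760 scanChain_44760 rfl rfl (by norm_num) (by norm_num)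

lemma scanChain_88944 : force factorial549 (fun P => scanChain P 7364
      [⟨9277, 423468244, 35484156, 4238, 3373⟩,
      ⟨9906, 486367785, 38158973, 4265, 3398⟩,
      ⟨10538, 554212155, 40863099, 4290, 3421⟩,
      ⟨11165, 626147046, 43561242, 4314, 3442⟩,
      ⟨11801, 703797742, 46312733, 4336, 3462⟩,
      ⟨12426, 784717769, 49030182, 4357, 3481⟩]
      88944 ⟨8615, 362159148, 32687789, 4208, 3346⟩) = true := by
  decide +kernel

lemma primeScanInv_133128 : PrimeScanInv 133128 12426 784717769 49030182 :=
  PrimeScanInv.trans primeScanInv_88944 scanChain_88944 rfl rfl (by norm_num) (by norm_num)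

lemma scanChain_133128 : force factorial549 (fun P => scanChain P 7364
      [⟨13051, 870233248, 51760386, 4377, 3499⟩,
      ⟨13666, 958904651, 54458797, 4396, 3517⟩,
      ⟨14292, 1053764823, 57216979, 4414, 3533⟩,
      ⟨14893, 1149256222, 59875530, 4431, 3548⟩,
      ⟨15493, 1248996604, 62539670, 4447, 3563⟩,
      ⟨16108, 1355772429, 65280283, 4463, 3577⟩]
      133128 ⟨12426, 784717769, 49030182, 4357, 3481⟩) = true := by
  decide +kernel

lemma primeScanInv_177312 : PrimeScanInv 177312 16108 1355772429 65280283 :=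
  PrimeScanInv.trans primeScanInv_133128 scanChain_133128 rfl rfl (by norm_num) (by norm_num)

lemma scanChain_177312 : force factorial549 (fun P => scanChain P 7364
      [⟨16719, 1466358490, 68012468, 4478, 3591⟩,
      ⟨17330, 1581416997, 70753599, 4493, 3604⟩,
      ⟨17934, 1699615997, 73471904, 4506, 3617⟩,
      ⟨18527, 1820044024, 76148828, 4520, 3629⟩,
      ⟨19140, 1949000591, 78924010, 4533, 3641⟩,
      ⟨19735, 2078629932, 81625398, 4545, 3652⟩]
      177312 ⟨16108, 1355772429, 65280283, 4463, 3577⟩) = true := by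
  decide +kernel

lemma primeScanInv_221496 : PrimeScanInv 221496 19735 2078629932 81625398 :=
  PrimeScanInv.trans primeScanInv_177312 scanChain_177312 rfl rfl (by norm_num) (by norm_num)

lemma scanChain_221496 : force factorial549 (fun P => scanChain P 7364
      [⟨20335, 2213740444, 84356809, 4557, 3663⟩,
      ⟨20922, 2350181763, 87035921, 4569, 3674⟩,
      ⟨21515, 2492469104, 89749366, 4580, 3684⟩,
      ⟨22110, 2639563497, 92478524, 4591, 3694⟩,
      ⟨22699, 2789501772, 95186545, 4602, 3704⟩,
      ⟨23283, 2942501870, 97877761, 4612, 3713⟩]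
      221496 ⟨19735, 2078629932, 81625398, 4545, 3652⟩) = true := by
  decide +kernel

lemma primeScanInv_265680 : PrimeScanInv 265680 23283 2942501870 97877761 :=
  PrimeScanInv.trans primeScanInv_221496 scanChain_221496 rfl rfl (by norm_num) (by norm_num)

lemma scanChain_265680 : force factorial549 (fun P => scanChain P 7364
      [⟨23890, 3105975133, 100681163, 4623, 3723⟩,
      ⟨24464, 3264813697, 103337912, 4632, 3732⟩,
      ⟨25046, 3430082373, 106037242, 4642, 3740⟩,
      ⟨25627, 3599405104, 108737503, 4651, 3749⟩,
      ⟨26193, 3768541684, 111373286, 4660, 3757⟩]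
      265680 ⟨23283, 2942501870, 97877761, 4612, 3713⟩) = true := by
  decide +kernel

lemma primeScanInv_302500 : PrimeScanInv 302500 26193 3768541684 111373286 :=
  PrimeScanInv.trans primeScanInv_265680 scanChain_265680 rfl rfl (by norm_num) (by norm_num)

open ArithmeticFunction in
lemma log_factorial_eq_sum_vonMangoldt (M : ℕ) :
    Real.log (Nat.factorial M) = ∑ n ∈ Finset.Ioc 0 M, Λ n * (M / n : ℕ) := by
  induction M with
  | zero => simp
  | succ M ih =>
    have h1 (n : ℕ) : Λ n * ((M + 1) / n : ℕ) =
        Λ n * (M / n : ℕ) + if n ∣ M + 1 then Λ n else 0 := by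
      rw [Nat.succ_div]
      split_ifs <;> push_cast <;> ring
    rw [Nat.factorial_succ, Nat.cast_mul, Real.log_mul (by positivity) (by positivity), ih,
      Finset.sum_congr rfl fun n _ => h1 n, Finset.sum_add_distrib, ← Finset.sum_filter,
      ← vonMangoldt_sum, add_comm, ← Finset.insert_Ioc_right_eq_Ioc_add_one (Nat.zero_le M),
      Finset.sum_insert (by simp), Nat.div_eq_of_lt (Nat.lt_add_one M)]
    congr 1
    · simp
    · refine Finset.sum_congr ?_ fun _ _ => rfl
      ext n
      simp only [Nat.mem_divisors, Finset.mem_filter, Finset.mem_insert, Finset.mem_Ioc]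
      constructor
      · rintro ⟨h, -⟩
        have := Nat.le_of_dvd (Nat.succ_pos M) h
        have := Nat.pos_of_dvd_of_pos h (Nat.succ_pos M)
        exact ⟨by omega, h⟩
      · exact fun h => ⟨h.2, by omega⟩

open ArithmeticFunction in
lemma log_factorial_sub_eq_sum_vonMangoldt (N d : ℕ) :
    Real.log (Nat.factorial N) - d * Real.log (Nat.factorial (N / d)) =
      ∑ n ∈ Finset.Ioc 0 N, Λ n * (N / n % d : ℕ) := by
  have h1 : ∑ n ∈ Finset.Ioc 0 (N / d), Λ n * (N / d / n : ℕ) =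
      ∑ n ∈ Finset.Ioc 0 N, Λ n * (N / d / n : ℕ) := by
    refine Finset.sum_subset (Finset.Ioc_subset_Ioc_right (Nat.div_le_self N d)) fun n hn hn' => ?_
    simp only [Finset.mem_Ioc, not_and, not_le] at hn hn'
    rw [Nat.div_eq_of_lt (hn' hn.1), Nat.cast_zero, mul_zero]
  rw [log_factorial_eq_sum_vonMangoldt, log_factorial_eq_sum_vonMangoldt, h1, Finset.mul_sum,
    ← Finset.sum_sub_distrib]
  refine Finset.sum_congr rfl fun n _ => ?_
  have h2 : (N / n : ℕ) = (N / n % d : ℕ) + d * (N / d / n : ℕ) := by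
    rw [Nat.div_div_eq_div_mul, mul_comm d n, ← Nat.div_div_eq_div_mul, Nat.mod_add_div]
  have h3 : ((N / n : ℕ) : ℝ) = (N / n % d : ℕ) + d * (N / d / n : ℕ) := by exact_mod_cast h2
  rw [h3]
  ring

lemma log_factorial_le {m : ℕ} (hm : 1 ≤ m) :
    Real.log (Nat.factorial m) ≤ m * Real.log m - m + Real.log m + 1 := by
  induction m, hm using Nat.le_induction with
  | base => simp
  | succ m hm ih =>
    have hm0 : (0 : ℝ) < m := by exact_mod_cast hm
    have h1 : Real.log m ≤ Real.log (m + 1) - 1 / (m + 1) := by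
      have h := Real.log_le_sub_one_of_pos (x := (m : ℝ) / (m + 1)) (by positivity)
      rw [Real.log_div (by positivity) (by positivity)] at h
      have h' : (m : ℝ) / (m + 1) - 1 = - (1 / (m + 1)) := by field_simp; ring
      linarith
    have h2 : (m + 1) * Real.log m ≤ (m + 1) * Real.log (m + 1) - 1 := by
      have := mul_le_mul_of_nonneg_left h1 (by positivity : (0 : ℝ) ≤ m + 1)
      rwa [mul_sub, mul_one_div_cancel (by positivity)] at this
    rw [Nat.factorial_succ, Nat.cast_mul, Real.log_mul (by positivity) (by positivity)]
    push_cast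
    linarith

lemma le_log_factorial {m : ℕ} (hm : 1 ≤ m) :
    m * Real.log m - m ≤ Real.log (Nat.factorial m) := by
  have hm0 : (0 : ℝ) < m := by exact_mod_cast hm
  have h := Real.pow_div_factorial_le_exp (m : ℝ) hm0.le m
  have := Real.log_le_log (by positivity) h
  rw [Real.log_exp, Real.log_div (by positivity) (by positivity), Real.log_pow] at this
  linarith

lemma abs_log_factorial_floor_sub_le {y : ℝ} (hy : 1 ≤ y) :
    |Real.log (Nat.factorial ⌊y⌋₊) - (y * Real.log y - y)| ≤ Real.log y + 1 := by
  have hy0 : 0 < y := by linarith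
  set m := ⌊y⌋₊
  have hm : 1 ≤ m := Nat.one_le_floor_iff _ |>.2 hy
  have hm0 : (0 : ℝ) < m := by exact_mod_cast hm
  have hmy : (m : ℝ) ≤ y := Nat.floor_le hy0.le
  have hym : y ≤ m + 1 := (Nat.lt_floor_add_one y).le
  have hl : 0 ≤ Real.log y := Real.log_nonneg hy
  have hlm : Real.log m ≤ Real.log y := Real.log_le_log hm0 hmy
  have h1 := log_factorial_le hm
  have h2 := le_log_factorial hm
  have h3 : m * (Real.log y - Real.log m) ≤ y - m := by
    have := Real.log_le_sub_one_of_pos (x := y / m) (by positivity)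
    rw [Real.log_div (by positivity) (by positivity)] at this
    have := mul_le_mul_of_nonneg_left this hm0.le
    rwa [mul_sub _ (y / m), mul_div_cancel₀ _ hm0.ne', mul_one] at this
  have h6 : y * (Real.log m - Real.log y) ≤ m - y := by
    have := Real.log_le_sub_one_of_pos (x := m / y) (by positivity)
    rw [Real.log_div (by positivity) (by positivity)] at this
    have := mul_le_mul_of_nonneg_left this hy0.le
    rwa [mul_sub _ (m / y), mul_div_cancel₀ _ hy0.ne', mul_one] at this
  have h4 : (y - m) * Real.log y ≤ 1 * Real.log y := by gcongr; linarith
  have h7 : 0 ≤ (y - m) * Real.log m :=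
    mul_nonneg (by linarith) (Real.log_nonneg (by exact_mod_cast hm))
  rw [abs_le]
  constructor <;> linarith

lemma abs_log_factorial_sub_le {N d : ℕ} (hd : 0 < d) (hdN : d ≤ N) :
    |Real.log (Nat.factorial N) - d * Real.log (Nat.factorial (N / d)) - N * Real.log d| ≤
      (d + 1) * (Real.log N + 1) := by
  have hd0 : (1 : ℝ) ≤ d := by exact_mod_cast hd
  have hdN' : (d : ℝ) ≤ N := by exact_mod_cast hdN
  have h1 := abs_log_factorial_floor_sub_le (y := N) (by linarith)
  have h2 := abs_log_factorial_floor_sub_le (y := N / d) ((one_le_div (by linarith)).2 hdN')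
  rw [Nat.floor_natCast] at h1
  rw [Nat.floor_div_natCast, Nat.floor_natCast, Real.log_div (by linarith) (by linarith)] at h2
  have hl : 0 ≤ Real.log d := Real.log_nonneg hd0
  have h3 : d * |Real.log (Nat.factorial (N / d)) -
      (N / d * (Real.log N - Real.log d) - N / d)| ≤ d * (Real.log N + 1) := by
    gcongr
    linarith
  rw [← Nat.abs_cast d, ← abs_mul, Nat.abs_cast d] at h3
  have h4 : (d : ℝ) * (Real.log (Nat.factorial (N / d)) -
      (N / d * (Real.log N - Real.log d) - N / d)) =
      d * Real.log (Nat.factorial (N / d)) - (N * (Real.log N - Real.log d) - N) := by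
    field_simp
  rw [h4] at h3
  rw [abs_le] at *
  constructor <;> linarith

/-- The sum of `k * (m % d)` over the pairs `(d, k)` in `l`. -/
def modSum (l : List (ℕ × ℕ)) (m : ℕ) : ℕ :=
  (l.map fun t => t.2 * (m % t.1)).sum

/-- The sum of `k * (log N! - d * log (N / d)!)` over the pairs `(d, k)` in `l`. -/
noncomputable def logFactorialSum (l : List (ℕ × ℕ)) (N : ℕ) : ℝ :=
  (l.map fun t => (t.2 : ℝ) * (Real.log (Nat.factorial N) -
    t.1 * Real.log (Nat.factorial (N / t.1)))).sum

/-- The product of `d ^ k` over the pairs `(d, k)` in `l`. -/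
def powProd (l : List (ℕ × ℕ)) : ℕ :=
  (l.map fun t => t.1 ^ t.2).prod

/-- The sum of `k * (d + 1)` over the pairs `(d, k)` in `l`. -/
def errorWeight (l : List (ℕ × ℕ)) : ℕ :=
  (l.map fun t => t.2 * (t.1 + 1)).sum

open ArithmeticFunction in
lemma logFactorialSum_eq_sum_vonMangoldt (N : ℕ) :
    ∀ l : List (ℕ × ℕ),
      logFactorialSum l N = ∑ n ∈ Finset.Ioc 0 N, Λ n * (modSum l (N / n) : ℕ)
  | [] => by simp [logFactorialSum, modSum]
  | t :: l => by
    have ih := logFactorialSum_eq_sum_vonMangoldt N l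
    simp only [logFactorialSum, modSum, List.map_cons, List.sum_cons] at ih ⊢
    rw [ih, log_factorial_sub_eq_sum_vonMangoldt N t.1, Finset.mul_sum,
      ← Finset.sum_add_distrib]
    refine Finset.sum_congr rfl fun n _ => ?_
    push_cast
    ring

lemma powProd_pos : ∀ {l : List (ℕ × ℕ)}, (∀ t ∈ l, 0 < t.1) → 0 < powProd l
  | [], _ => by simp [powProd]
  | t :: l, h => by
    have ih := powProd_pos fun s hs => h s (List.mem_cons_of_mem t hs)
    simp only [powProd, List.map_cons, List.prod_cons] at ih ⊢
    exact Nat.mul_pos (Nat.pow_pos (h t List.mem_cons_self)) ih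

lemma abs_logFactorialSum_sub_le {N : ℕ} :
    ∀ {l : List (ℕ × ℕ)}, (∀ t ∈ l, 0 < t.1) → (∀ t ∈ l, t.1 ≤ N) →
      |logFactorialSum l N - N * Real.log (powProd l)| ≤ errorWeight l * (Real.log N + 1)
  | [], _, _ => by simp [logFactorialSum, powProd, errorWeight]
  | t :: l, h, h' => by
    have hl : ∀ s ∈ l, 0 < s.1 := fun s hs => h s (List.mem_cons_of_mem t hs)
    have ih := abs_logFactorialSum_sub_le hl fun s hs => h' s (List.mem_cons_of_mem t hs)
    have ht := h t List.mem_cons_self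
    have h1 := abs_log_factorial_sub_le ht (h' t List.mem_cons_self)
    have h2 := mul_le_mul_of_nonneg_left h1 (Nat.cast_nonneg (α := ℝ) t.2)
    rw [← Nat.abs_cast t.2, ← abs_mul, Nat.abs_cast t.2] at h2
    have h3 := powProd_pos hl
    simp only [logFactorialSum, powProd, errorWeight, List.map_cons, List.sum_cons,
      List.prod_cons] at ih h3 ⊢
    rw [Nat.cast_mul, Real.log_mul (by positivity) (by positivity), Nat.cast_pow, Real.log_pow]
    have h4 := (abs_add_le _ _).trans (add_le_add h2 ih)
    refine le_trans (le_of_eq ?_) (h4.trans (le_of_eq ?_))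
    · congr 1
      ring
    · push_cast
      ring

/-- The sum of the `t` over the pairs `(y, t)` in `l` with `y ≤ m`. -/
def stepSum (l : List (ℕ × ℕ)) (m : ℕ) : ℕ :=
  (l.map fun t => if t.1 ≤ m then t.2 else 0).sum

open ArithmeticFunction in
lemma Chebyshev.psi_natCast (N : ℕ) : Chebyshev.psi N = ∑ n ∈ Finset.Ioc 0 N, Λ n := by
  rw [Chebyshev.psi, Nat.floor_natCast]

open ArithmeticFunction in
lemma sum_vonMangoldt_mul_stepSum (N : ℕ) : ∀ {l : List (ℕ × ℕ)}, (∀ t ∈ l, 0 < t.1) →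
    ∑ n ∈ Finset.Ioc 0 N, Λ n * (stepSum l (N / n) : ℕ) =
      (l.map fun t => (t.2 : ℝ) * Chebyshev.psi (N / t.1 : ℕ)).sum
  | [], _ => by simp [stepSum]
  | t :: l, h => by
    have ih := sum_vonMangoldt_mul_stepSum N fun s hs => h s (List.mem_cons_of_mem t hs)
    simp only [stepSum, List.map_cons, List.sum_cons] at ih ⊢
    have ht := h t List.mem_cons_self
    rw [← ih, Chebyshev.psi_natCast, Finset.mul_sum]
    have h1 : ∑ n ∈ Finset.Ioc 0 (N / t.1), (t.2 : ℝ) * Λ n =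
        ∑ n ∈ Finset.Ioc 0 N, Λ n * (if t.1 ≤ N / n then t.2 else 0 : ℕ) := by
      rw [Finset.sum_subset_zero_on_sdiff
        (Finset.Ioc_subset_Ioc_right (Nat.div_le_self N t.1)) (g := fun n => _)]
      · intro n hn
        simp only [Finset.mem_sdiff, Finset.mem_Ioc, not_and, not_le] at hn
        have := (Nat.div_lt_iff_lt_mul ht).1 (hn.2 hn.1.1)
        rw [if_neg (by rw [not_le, Nat.div_lt_iff_lt_mul hn.1.1]; linarith), Nat.cast_zero,
          mul_zero]
      · intro n hn
        rw [Finset.mem_Ioc] at hn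
        rw [if_pos, mul_comm]
        rw [Nat.le_div_iff_mul_le hn.1, mul_comm]
        exact (Nat.le_div_iff_mul_le ht).1 hn.2
    rw [h1, ← Finset.sum_add_distrib]
    refine Finset.sum_congr rfl fun n _ => ?_
    push_cast
    ring

/-- A form of Chebyshev's lower bound for `ψ`. -/
lemma logFactorialSum_sub_le {pos neg steps : List (ℕ × ℕ)} {Q : ℕ} (hs : ∀ t ∈ steps, 0 < t.1)
    (h : ∀ m, 1 ≤ m → modSum pos m ≤ modSum neg m + Q + stepSum steps m) (N : ℕ) :
    logFactorialSum pos N - logFactorialSum neg N ≤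
      Q * Chebyshev.psi N + (steps.map fun t => (t.2 : ℝ) * Chebyshev.psi (N / t.1 : ℕ)).sum := by
  rw [sub_le_iff_le_add', logFactorialSum_eq_sum_vonMangoldt, logFactorialSum_eq_sum_vonMangoldt,
    ← sum_vonMangoldt_mul_stepSum N hs, Chebyshev.psi_natCast, Finset.mul_sum,
    ← Finset.sum_add_distrib, ← Finset.sum_add_distrib]
  refine Finset.sum_le_sum fun n hn => ?_
  rw [Finset.mem_Ioc] at hn
  have h1 := h (N / n) (Nat.div_pos hn.2 hn.1)
  have h2 : (modSum pos (N / n) : ℝ) ≤ modSum neg (N / n) + Q + stepSum steps (N / n) := by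
    exact_mod_cast h1
  have h3 := mul_le_mul_of_nonneg_left h2
    (ArithmeticFunction.vonMangoldt_nonneg : 0 ≤ ArithmeticFunction.vonMangoldt n)
  linarith

/-- A form of Chebyshev's upper bound for `ψ`. -/
lemma mul_psi_sub_psi_le {pos neg : List (ℕ × ℕ)} {Q K : ℕ} (hK : 0 < K)
    (h0 : ∀ m, modSum neg m ≤ modSum pos m)
    (h : ∀ m, 1 ≤ m → m < K → modSum neg m + Q ≤ modSum pos m) (N : ℕ) :
    Q * (Chebyshev.psi N - Chebyshev.psi (N / K : ℕ)) ≤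
      logFactorialSum pos N - logFactorialSum neg N := by
  have h1 : Chebyshev.psi N - Chebyshev.psi (N / K : ℕ) =
      ∑ n ∈ Finset.Ioc (N / K) N, ArithmeticFunction.vonMangoldt n := by
    rw [Chebyshev.psi_natCast, Chebyshev.psi_natCast, sub_eq_iff_eq_add',
      Finset.sum_Ioc_consecutive _ (Nat.zero_le _) (Nat.div_le_self N K)]
  have hsub : Finset.Ioc (N / K) N ⊆ Finset.Ioc 0 N := Finset.Ioc_subset_Ioc_left (Nat.zero_le _)
  rw [h1, logFactorialSum_eq_sum_vonMangoldt, logFactorialSum_eq_sum_vonMangoldt,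
    ← Finset.sum_sub_distrib, Finset.mul_sum]
  refine le_trans (Finset.sum_le_sum fun n hn => ?_)
    (Finset.sum_le_sum_of_subset_of_nonneg hsub fun n _ _ => ?_)
  · rw [Finset.mem_Ioc] at hn
    have hn0 : 0 < n := (Nat.zero_le _).trans_lt hn.1
    have h2 := h (N / n) (Nat.div_pos hn.2 hn0) (by
      rw [Nat.div_lt_iff_lt_mul hn0, mul_comm]
      exact (Nat.div_lt_iff_lt_mul hK).1 hn.1)
    have h3 : (modSum neg (N / n) : ℝ) + Q ≤ modSum pos (N / n) := by exact_mod_cast h2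
    have h4 := mul_le_mul_of_nonneg_left h3
      (ArithmeticFunction.vonMangoldt_nonneg : 0 ≤ ArithmeticFunction.vonMangoldt n)
    linarith
  · have h3 : (modSum neg (N / n) : ℝ) ≤ modSum pos (N / n) := by exact_mod_cast h0 (N / n)
    have h4 := mul_le_mul_of_nonneg_left h3
      (ArithmeticFunction.vonMangoldt_nonneg : 0 ≤ ArithmeticFunction.vonMangoldt n)
    linarith

/-- Check that the least common multiple `l` of `1, …, n` satisfies `l ^ 5 ≤ 2 ^ (8 * n)`, and
likewise for the next `m` integers. -/
def lcmScan (m : ℕ) : ℕ → ℕ → Bool :=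
  Nat.rec (motive := fun _ => ℕ → ℕ → Bool) (fun _ _ => true)
    (fun _ ih n l => cond (Nat.ble (Nat.pow l 5) (Nat.pow 2 (Nat.mul 8 n)))
      (force (Nat.succ n) fun n' => force (Nat.div (Nat.mul l n') (Nat.gcd l n')) fun l' =>
        ih n' l') false) m

lemma lcmUpto_pow_le_of_lcmScan (m : ℕ) : ∀ {n : ℕ},
    lcmScan m n (Nat.lcmUpto n) = true →
    ∀ N, n ≤ N → N < n + m → Nat.lcmUpto N ^ 5 ≤ 2 ^ (8 * N) := by
  induction m with
  | zero => intros; omega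
  | succ m ih =>
    intro n h N h1 h2
    have h : cond (Nat.ble (Nat.pow (Nat.lcmUpto n) 5) (Nat.pow 2 (Nat.mul 8 n)))
      (force (Nat.succ n) fun n' => force (Nat.lcm (Nat.lcmUpto n) n') fun l' =>
        lcmScan m n' l') false = true := h
    rw [Bool.cond_false_right, Bool.and_eq_true, Nat.ble_eq, force_eq, force_eq] at h
    rcases eq_or_ne N n with rfl | hne
    · exact h.1
    · refine ih (n := n + 1) ?_ N (by omega) (by omega)
      have : Nat.lcmUpto (n + 1) = Nat.lcm (Nat.lcmUpto n) (n + 1) := by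
        rw [Nat.lcmUpto, Nat.lcmUpto, Nat.lcm_comm,
          ← Finset.insert_Icc_right_eq_Icc_add_one (by omega), Finset.lcm_insert]
        rfl
      rw [this]
      exact h.2

lemma lcmScan_eq_true : lcmScan 2500 0 1 = true := by
  decide +kernel

lemma Chebyshev.psi_natCast_le (N : ℕ) : Chebyshev.psi N ≤ 1.13 * N := by
  have hlog2 := Real.log_two_lt_d9
  induction N using Nat.strong_induction_on with
  | _ N ih =>
    rcases lt_or_ge N 2500 with hN | hN
    · have h := lcmUpto_pow_le_of_lcmScan 2500 (n := 0)
        (by rw [show Nat.lcmUpto 0 = 1 from rfl]; exact lcmScan_eq_true) N (Nat.zero_le N)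
        (by omega)
      have h1 : (Nat.lcmUpto N : ℝ) ^ 5 ≤ 2 ^ (8 * N) := by exact_mod_cast h
      have h2 := Real.log_le_log
        (pow_pos (Nat.cast_pos.2 (Nat.lcmUpto_pos N)) 5) h1
      rw [Real.log_pow, Real.log_pow, ← Chebyshev.psi_eq_log_lcmUpto] at h2
      push_cast at h2
      nlinarith [Nat.cast_nonneg (α := ℝ) N]
    · have hmod (m : ℕ) : modSum [(30, 1)] m ≤ modSum [(2, 15), (3, 10), (5, 6)] m := by
        simp only [modSum, List.map_cons, List.map_nil, List.sum_cons, List.sum_nil]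
        omega
      have hmod' (m : ℕ) (h1 : 1 ≤ m) (h2 : m < 6) :
          modSum [(30, 1)] m + 30 ≤ modSum [(2, 15), (3, 10), (5, 6)] m := by
        simp only [modSum, List.map_cons, List.map_nil, List.sum_cons, List.sum_nil]
        omega
      have h1 := mul_psi_sub_psi_le (by norm_num) hmod hmod' N
      have h2 := abs_logFactorialSum_sub_le (N := N) (l := [(2, 15), (3, 10), (5, 6)])
        (by simp) (by simp; omega)
      have h3 := abs_logFactorialSum_sub_le (N := N) (l := [(30, 1)]) (by simp) (by simp; omega)
      rw [abs_le] at h2 h3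
      have h4 : Real.log (powProd [(2, 15), (3, 10), (5, 6)]) - Real.log (powProd [(30, 1)]) ≤
          27.66 := by
        have : ((powProd [(2, 15), (3, 10), (5, 6)] : ℝ)) ^ 10 ≤
            2 ^ 399 * (powProd [(30, 1)] : ℝ) ^ 10 := by
          exact_mod_cast (by decide +kernel : powProd [(2, 15), (3, 10), (5, 6)] ^ 10 ≤
            2 ^ 399 * powProd [(30, 1)] ^ 10)
        have := Real.log_le_log (by norm_num [powProd]) this
        rw [Real.log_mul (by positivity) (by norm_num [powProd]), Real.log_pow, Real.log_pow,
          Real.log_pow] at this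
        push_cast at this
        linarith
      have h5 : (errorWeight [(2, 15), (3, 10), (5, 6)] : ℝ) + errorWeight [(30, 1)] = 152 := by
        norm_num [errorWeight]
      have h6 : Real.log N + 1 ≤ 7.93 + N / 2500 := by
        have hN0 : (0 : ℝ) < N := by exact_mod_cast (by omega : 0 < N)
        have h := Real.log_le_sub_one_of_pos (x := (N : ℝ) / 2500) (by positivity)
        rw [Real.log_div (by positivity) (by positivity)] at h
        have : (2500 : ℝ) ^ 7 ≤ 2 ^ 80 := by norm_num
        have := Real.log_le_log (by norm_num) this
        rw [Real.log_pow, Real.log_pow] at this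
        push_cast at this
        linarith
      have h7 := ih (N / 6) (by omega)
      have h8 : ((N / 6 : ℕ) : ℝ) ≤ N / 6 := Nat.cast_div_le
      have hN' : (2500 : ℝ) ≤ N := by exact_mod_cast hN
      have h9 := mul_le_mul_of_nonneg_left h4 (by linarith : (0 : ℝ) ≤ N)
      have h10 : (errorWeight [(2, 15), (3, 10), (5, 6)] : ℝ) * (Real.log N + 1) +
          errorWeight [(30, 1)] * (Real.log N + 1) ≤ 152 * (7.93 + N / 2500) := by
        rw [← add_mul, h5]
        gcongr
      push_cast at h1
      linarith

lemma Chebyshev.psi_le_mul {x : ℝ} (hx : 0 ≤ x) : Chebyshev.psi x ≤ 1.13 * x := by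
  rw [Chebyshev.psi_eq_psi_coe_floor]
  have := Chebyshev.psi_natCast_le ⌊x⌋₊
  have := Nat.floor_le hx
  linarith

/-- The positive weights in a linear combination approximating the von Mangoldt function. -/
def posWeights : List (ℕ × ℕ) := [
  (2, 5000), (3, 3333), (5, 2000), (7, 1429), (11, 909), (13, 769), (17, 588), (19, 526), (23,
  435), (29, 345), (30, 333), (31, 323), (37, 141), (42, 238), (43, 233), (47, 114), (53, 189),
  (59, 239), (61, 97), (66, 208), (67, 11), (69, 13), (70, 74), (73, 137), (77, 20), (79, 73),
  (83, 120), (87, 40), (97, 33), (102, 63), (103, 11), (105, 50), (107, 43), (110, 91), (113,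
  81), (114, 88), (127, 9), (130, 36)]

/-- The negative weights in a linear combination approximating the von Mangoldt function. -/
def negWeights : List (ℕ × ℕ) := [
  (6, 1667), (10, 1000), (14, 714), (15, 667), (21, 476), (22, 455), (26, 385), (33, 303), (34,
  294), (35, 149), (38, 263), (46, 117), (51, 196), (55, 182), (57, 175), (58, 172), (62, 161),
  (65, 53), (71, 27), (74, 70), (78, 95), (85, 118), (86, 116), (89, 39), (93, 21), (94, 28),
  (101, 7), (106, 94), (111, 39), (115, 87), (118, 149), (119, 64), (122, 49), (129, 10)]

/-- Corrections making `posWeights` and `negWeights` a minorant. -/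
def stepWeights : List (ℕ × ℕ) := [
  (3, 1), (6, 8), (17, 52), (79, 105), (109, 9851), (173, 7802), (510, 3286), (863, 4262),
  (1231, 5451), (3469, 9991), (10001, 218294)]

/-- `modSum`, in a form suited to evaluation in the kernel. -/
def modSumAux (l : List (ℕ × ℕ)) (m : ℕ) : ℕ :=
  List.rec (motive := fun _ => ℕ) 0
    (fun t _ ih => Nat.add (Nat.mul t.2 (Nat.mod m t.1)) ih) l

lemma modSumAux_eq (l : List (ℕ × ℕ)) (m : ℕ) : modSumAux l m = modSum l m := by
  induction l with
  | nil => rfl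
  | cons t l ih =>
    rw [modSum, List.map_cons, List.sum_cons, ← modSum, ← ih]
    rfl

/-- `stepSum`, in a form suited to evaluation in the kernel. -/
def stepSumAux (l : List (ℕ × ℕ)) (m : ℕ) : ℕ :=
  List.rec (motive := fun _ => ℕ) 0
    (fun t _ ih => cond (Nat.ble t.1 m) (Nat.add t.2 ih) ih) l

lemma stepSumAux_eq (l : List (ℕ × ℕ)) (m : ℕ) : stepSumAux l m = stepSum l m := by
  induction l with
  | nil => rfl
  | cons t l ih =>
    rw [stepSum, List.map_cons, List.sum_cons, ← stepSum, ← ih]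
    change cond (Nat.ble t.1 m) (t.2 + stepSumAux l m) (stepSumAux l m) = _
    by_cases h : t.1 ≤ m
    · rw [Nat.ble_eq.mpr h, if_pos h, cond_true]
    · rw [Bool.eq_false_iff.mpr (mt Nat.ble_eq.mp h), if_neg h, cond_false, zero_add]

/-- Check the minorant property for `m` consecutive integers from `n` on. -/
def minorantScan (m : ℕ) : ℕ → Bool :=
  Nat.rec (motive := fun _ => ℕ → Bool) (fun _ => true)
    (fun _ ih n => cond (Nat.ble (modSumAux posWeights n)
        (Nat.add (Nat.add (modSumAux negWeights n) 10000) (stepSumAux stepWeights n)))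
      (force (Nat.succ n) ih) false) m

lemma modSum_le_of_minorantScan (m : ℕ) : ∀ {n : ℕ}, minorantScan m n = true →
    ∀ N, n ≤ N → N < n + m →
      modSum posWeights N ≤ modSum negWeights N + 10000 + stepSum stepWeights N := by
  induction m with
  | zero => intros; omega
  | succ m ih =>
    intro n h N h1 h2
    have h : cond (Nat.ble (modSumAux posWeights n)
        (modSumAux negWeights n + 10000 + stepSumAux stepWeights n))
      (force (Nat.succ n) (minorantScan m)) false = true := h
    rw [Bool.cond_false_right, Bool.and_eq_true, Nat.ble_eq, force_eq, modSumAux_eq, modSumAux_eq,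
      stepSumAux_eq] at h
    rcases eq_or_ne N n with rfl | hne
    · exact h.1
    · exact ih h.2 N (by omega) (by omega)

lemma minorantScan_eq_true : minorantScan 10001 0 = true := by
  decide +kernel

lemma modSum_le : ∀ {l : List (ℕ × ℕ)}, (∀ t ∈ l, 0 < t.1) → ∀ m,
    modSum l m ≤ (l.map fun t => t.2 * (t.1 - 1)).sum
  | [], _, _ => by simp [modSum]
  | t :: l, h, m => by
    have ih := modSum_le (fun s hs => h s (List.mem_cons_of_mem t hs)) m
    have := Nat.mod_lt m (h t List.mem_cons_self)
    simp only [modSum, List.map_cons, List.sum_cons] at ih ⊢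
    gcongr
    omega

lemma weights_pos : (∀ t ∈ posWeights, 0 < t.1) ∧ (∀ t ∈ negWeights, 0 < t.1) ∧
    ∀ t ∈ stepWeights, 0 < t.1 := by
  decide +kernel

lemma weights_le : (∀ t ∈ posWeights, t.1 ≤ 130) ∧ ∀ t ∈ negWeights, t.1 ≤ 130 := by
  decide +kernel

lemma modSum_posWeights_le (m : ℕ) :
    modSum posWeights m ≤ modSum negWeights m + 10000 + stepSum stepWeights m := by
  rcases lt_or_ge m 10001 with hm | hm
  · exact modSum_le_of_minorantScan 10001 minorantScan_eq_true m (Nat.zero_le m) (by omega)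
  · have h1 := modSum_le weights_pos.1 m
    have h2 : (posWeights.map fun t => t.2 * (t.1 - 1)).sum = 269103 := by decide +kernel
    have h3 : stepSum stepWeights m = 259103 := by
      simp only [stepSum, stepWeights, List.map_cons, List.map_nil, List.sum_cons, List.sum_nil]
      repeat rw [if_pos (by omega)]
      norm_num
    omega

lemma two_pow_mul_powProd_le :
    2 ^ 14301 * powProd negWeights ≤ powProd posWeights := by
  decide +kernel

lemma errorWeight_weights : errorWeight posWeights + errorWeight negWeights = 578458 := by
  decide +kernel

lemma sum_stepWeights_mul_psi_le (N : ℕ) :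
    (stepWeights.map fun t => (t.2 : ℝ) * Chebyshev.psi (N / t.1 : ℕ)).sum ≤ 205.713 * N := by
  have h (t d : ℕ) : (t : ℝ) * Chebyshev.psi (N / d : ℕ) ≤ t * (1.13 * (N / d)) := by
    have h1 := Chebyshev.psi_natCast_le (N / d)
    have h2 : ((N / d : ℕ) : ℝ) ≤ N / d := Nat.cast_div_le
    gcongr
    linarith
  have hN : (0 : ℝ) ≤ N := Nat.cast_nonneg N
  calc (stepWeights.map fun t => (t.2 : ℝ) * Chebyshev.psi (N / t.1 : ℕ)).sum
      ≤ (stepWeights.map fun t => (t.2 : ℝ) * (1.13 * (N / t.1))).sum :=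
        List.sum_le_sum fun t _ => h _ _
    _ ≤ 205.713 * N := by
        simp only [stepWeights, List.map_cons, List.map_nil, List.sum_cons, List.sum_nil]
        push_cast
        linarith

lemma Chebyshev.le_psi {N : ℕ} (hN : 302499 ≤ N) : 0.968 * N ≤ Chebyshev.psi N := by
  have hN' : (302499 : ℝ) ≤ N := by exact_mod_cast hN
  have h1 := logFactorialSum_sub_le weights_pos.2.2 (fun m _ => modSum_posWeights_le m) N
  have h2 := abs_logFactorialSum_sub_le (N := N) weights_pos.1
    fun t ht => (weights_le.1 t ht).trans (by omega)
  have h3 := abs_logFactorialSum_sub_le (N := N) weights_pos.2.1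
    fun t ht => (weights_le.2 t ht).trans (by omega)
  rw [abs_le] at h2 h3
  have h4 := sum_stepWeights_mul_psi_le N
  have hlog2 := Real.log_two_gt_d9
  have hlog2' := Real.log_two_lt_d9
  have h5 : 9912.69 ≤ Real.log (powProd posWeights) - Real.log (powProd negWeights) := by
    have hn : (0 : ℝ) < powProd negWeights := by exact_mod_cast powProd_pos weights_pos.2.1
    have h : (2 : ℝ) ^ 14301 * powProd negWeights ≤ powProd posWeights := by
      exact_mod_cast two_pow_mul_powProd_le
    have := Real.log_le_log (mul_pos (pow_pos two_pos _) hn) h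
    rw [Real.log_mul (pow_pos two_pos _).ne' hn.ne', Real.log_pow] at this
    push_cast at this
    linarith
  have h6 : (errorWeight posWeights : ℝ) + errorWeight negWeights = 578458 := by
    exact_mod_cast errorWeight_weights
  have h7 : Real.log N + 1 ≤ 12.63 + N / 302499 := by
    have hN0 : (0 : ℝ) < N := by linarith
    have h := Real.log_le_sub_one_of_pos (x := (N : ℝ) / 302499) (by positivity)
    rw [Real.log_div (by positivity) (by norm_num)] at h
    have : (302499 : ℝ) ^ 24 ≤ 2 ^ 437 := by
      exact_mod_cast (by decide +kernel : (302499 : ℕ) ^ 24 ≤ 2 ^ 437)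
    have := Real.log_le_log (pow_pos (by norm_num) _) this
    rw [Real.log_pow, Real.log_pow] at this
    push_cast at this
    linarith
  have h8 : (errorWeight posWeights : ℝ) * (Real.log N + 1) +
      errorWeight negWeights * (Real.log N + 1) ≤ 578458 * (12.63 + N / 302499) := by
    rw [← add_mul, h6]
    gcongr
  have h9 := mul_le_mul_of_nonneg_left h5 (by linarith : (0 : ℝ) ≤ N)
  push_cast at h1
  linarith

lemma rpow_inv_le_div {x r : ℝ} {k : ℕ} (hr : 0 < r) (hx : r ^ (k + 1) ≤ x) :
    x ^ ((k + 1 : ℝ)⁻¹) ≤ x / r ^ k := by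
  have hx0 : 0 < x := lt_of_lt_of_le (by positivity) hx
  have h1 : (x ^ ((k + 1 : ℝ)⁻¹)) ^ (k + 1) = x := by
    have := Real.rpow_inv_natCast_pow hx0.le (Nat.succ_ne_zero k)
    rwa [Nat.cast_succ] at this
  have h2 : r ≤ x ^ ((k + 1 : ℝ)⁻¹) := by
    rw [← h1] at hx
    exact le_of_pow_le_pow_left₀ (Nat.succ_ne_zero k) (by positivity) hx
  rw [le_div_iff₀ (by positivity)]
  calc x ^ ((k + 1 : ℝ)⁻¹) * r ^ k ≤ x ^ ((k + 1 : ℝ)⁻¹) * (x ^ ((k + 1 : ℝ)⁻¹)) ^ k := by gcongr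
    _ = x := by rw [← pow_succ', h1]

lemma Chebyshev.le_theta_natCast {N : ℕ} (hN : 302499 ≤ N) :
    0.9645 * (N + 1) ≤ Chebyshev.theta N := by
  have hN' : (302499 : ℝ) ≤ N := by exact_mod_cast hN
  have hN0 : (0 : ℝ) ≤ N := by linarith
  have h1 := Chebyshev.le_psi hN
  have h2 := Chebyshev.psi_sub_theta_le_psi_add_psi_add_psi N
  have h3 {a y : ℝ} (h : (N : ℝ) ^ a ≤ y) : Chebyshev.psi ((N : ℝ) ^ a) ≤ 1.13 * y :=
    (Chebyshev.psi_le_mul (by positivity)).trans (by gcongr)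
  have h4 := rpow_inv_le_div (x := N) (r := 549) (k := 1) (by norm_num) (by norm_num; linarith)
  have h5 := rpow_inv_le_div (x := N) (r := 67) (k := 2) (by norm_num) (by norm_num; linarith)
  have h6 := rpow_inv_le_div (x := N) (r := 12) (k := 4) (by norm_num) (by norm_num; linarith)
  norm_num at h4 h5 h6 h2
  have h4' := h3 h4
  have h5' := h3 h5
  have h6' := h3 h6
  linarith

lemma Chebyshev.le_theta {x : ℝ} (hx : 302499 ≤ x) : 0.9645 * x ≤ Chebyshev.theta x := by
  have h1 : 302499 ≤ ⌊x⌋₊ := Nat.le_floor (by exact_mod_cast hx)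
  have h2 := Chebyshev.le_theta_natCast h1
  rw [Chebyshev.theta_eq_theta_coe_floor]
  have := Nat.lt_floor_add_one x
  linarith

lemma primeCounting_302499 : Nat.primeCounting 302499 = 26193 :=
  primeScanInv_302500.count

lemma Chebyshev.theta_natCast (n : ℕ) :
    Chebyshev.theta n = ∑ p ∈ (Finset.range (n + 1)).filter Nat.Prime, Real.log p := by
  rw [Chebyshev.theta_eq_sum_Icc, Nat.floor_natCast, Nat.range_succ_eq_Icc_zero]

lemma theta_302499_le : Chebyshev.theta 302499 ≤ 301556 := by
  have h1 := Chebyshev.theta_natCast 302499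
  rw [Nat.cast_ofNat] at h1
  rw [h1]
  refine primeScanInv_302500.log.trans ?_
  have := Real.log_two_lt_d9
  push_cast
  linarith

lemma le_log_302499 : 12.61 ≤ Real.log 302499 := by
  have h : (2 : ℝ) ^ 91 ≤ 302499 ^ 5 := by norm_num
  have h := Real.log_le_log (by norm_num) h
  rw [Real.log_pow, Real.log_pow] at h
  have := Real.log_two_gt_d9
  push_cast at h
  linarith

lemma hasDerivAt_mul_log_div {t : ℝ} (ht : 0 < t) (h1 : 2 ≤ Real.log t) :
    HasDerivAt (fun t => t * (Real.log t / (Real.log t ^ 2 - Real.log t - 1)) - t / Real.log t)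
      (Real.log t / (Real.log t ^ 2 - Real.log t - 1)
        - (Real.log t ^ 2 + 1) / (Real.log t ^ 2 - Real.log t - 1) ^ 2
        - 1 / Real.log t + 1 / Real.log t ^ 2) t := by
  have hl := Real.hasDerivAt_log ht.ne'
  have hD : Real.log t ^ 2 - Real.log t - 1 ≠ 0 := by nlinarith
  have hL : Real.log t ≠ 0 := by linarith
  have h := ((hasDerivAt_id t).mul (hl.div (((hl.pow 2).sub hl).sub_const 1) hD)).sub
    ((hasDerivAt_id t).div hl hL)
  refine h.congr_deriv ?_
  simp only [id, Pi.pow_apply, Pi.sub_apply, Pi.div_apply]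
  field_simp
  ring

lemma le_primeCounting {x : ℝ} (hx : 302499 ≤ x) :
    0.9645 * (x * (Real.log x / (Real.log x ^ 2 - Real.log x - 1))) ≤ Nat.primeCounting ⌊x⌋₊ := by
  set G : ℝ → ℝ := fun t =>
    t * (Real.log t / (Real.log t ^ 2 - Real.log t - 1)) - t / Real.log t with hG
  have hlog {t : ℝ} (ht : 302499 ≤ t) : 12.61 ≤ Real.log t :=
    le_log_302499.trans (Real.log_le_log (by norm_num) ht)
  have hderiv {t : ℝ} (ht : 302499 ≤ t) := hasDerivAt_mul_log_div (t := t) (by linarith)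
    (by linarith [hlog ht])
  have hint (a b : ℝ) (ha : 2 ≤ a) :
      MeasureTheory.IntegrableOn (fun t => Chebyshev.theta t / (t * Real.log t ^ 2))
        (Set.Icc a b) MeasureTheory.volume :=
    (Chebyshev.integrableOn_theta_div_id_mul_log_sq b).mono_set (Set.Icc_subset_Icc_left ha)
  have h1 : 0.9645 * G x - 0.9645 * G 302499 ≤
      ∫ t in (302499)..x, Chebyshev.theta t / (t * Real.log t ^ 2) := by
    refine intervalIntegral.sub_le_integral_of_hasDeriv_right_of_le hx
      (g := fun t => 0.9645 * G t)
      (fun t ht => ((hderiv ht.1).const_mul 0.9645).continuousAt.continuousWithinAt)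
      (fun t ht => ((hderiv ht.1.le).const_mul 0.9645).hasDerivWithinAt)
      (hint _ _ (by norm_num)) fun t ht => ?_
    have hL := hlog ht.1.le
    have ht0 : 0 < t := by linarith [ht.1]
    set L := Real.log t
    have hD : 0 < L ^ 2 - L - 1 := by nlinarith
    have hL0 : 0 < L := by linarith
    have h2 : L / (L ^ 2 - L - 1) - (L ^ 2 + 1) / (L ^ 2 - L - 1) ^ 2 ≤ 1 / L := by
      rw [div_sub_div _ _ hD.ne' (by positivity), div_le_div_iff₀ (by positivity) hL0]
      have : 0 ≤ (L ^ 2 - L - 1) * (3 * L + 1) := by positivity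
      linarith
    calc 0.9645 * (L / (L ^ 2 - L - 1) - (L ^ 2 + 1) / (L ^ 2 - L - 1) ^ 2 - 1 / L + 1 / L ^ 2)
        ≤ 0.9645 * (1 / L ^ 2) := by linarith
      _ = 0.9645 * t / (t * L ^ 2) := by field_simp
      _ ≤ Chebyshev.theta t / (t * L ^ 2) := by
        gcongr
        exact Chebyshev.le_theta ht.1.le
  have h2 := Chebyshev.primeCounting_eq_theta_div_log_add_integral (x := x) (by linarith)
  have h3 := Chebyshev.primeCounting_eq_theta_div_log_add_integral (x := 302499) (by norm_num)
  rw [show ⌊(302499 : ℝ)⌋₊ = 302499 from Nat.floor_ofNat 302499, primeCounting_302499] at h3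
  have hii (a b : ℝ) (ha : 2 ≤ a) (hab : a ≤ b) : IntervalIntegrable
      (fun t => Chebyshev.theta t / (t * Real.log t ^ 2)) MeasureTheory.volume a b :=
    (intervalIntegrable_iff_integrableOn_Icc_of_le hab).2 (hint a b ha)
  rw [← intervalIntegral.integral_add_adjacent_intervals (hii 2 302499 le_rfl (by norm_num))
    (hii 302499 x (by norm_num) hx)] at h2
  have hL := hlog hx
  have h4 : 0.9645 * (x / Real.log x) ≤ Chebyshev.theta x / Real.log x := by
    rw [← mul_div_assoc]
    gcongr
    exact Chebyshev.le_theta hx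
  have h5 : Chebyshev.theta 302499 / Real.log 302499 + 0.9645 * G 302499 ≤ 26193 := by
    have hL := le_log_302499
    simp only [hG]
    set L := Real.log 302499
    have hD : 145.4 ≤ L ^ 2 - L - 1 := by nlinarith
    have hL0 : 0 < L := by linarith
    have h6 : L / (L ^ 2 - L - 1) - 1 / L = (1 + 1 / L) / (L ^ 2 - L - 1) := by
      have hD' : L ^ 2 - L - 1 ≠ 0 := by linarith
      rw [div_sub_div _ _ hD' hL0.ne', div_eq_div_iff (mul_ne_zero hD' hL0.ne') hD']
      have h : L * (1 / L) = 1 := mul_one_div_cancel hL0.ne'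
      linear_combination -(L ^ 2 - L - 1) * h
    have h7 : (1 + 1 / L) / (L ^ 2 - L - 1) ≤ (1 + 1 / 12.61) / 145.4 := by gcongr
    have h8 : Chebyshev.theta 302499 / L ≤ 301556 / 12.61 := by
      gcongr
      exact theta_302499_le
    have h9 : 302499 * (L / (L ^ 2 - L - 1)) - 302499 / L =
        302499 * (L / (L ^ 2 - L - 1) - 1 / L) := by ring
    rw [h9, h6]
    linarith
  have h10 : G x = x * (Real.log x / (Real.log x ^ 2 - Real.log x - 1)) - x / Real.log x := rfl
  push_cast at h3
  linarith

lemma log_le_tangent {v v₀ : ℝ} (hv : 0 < v) (hv₀ : 0 < v₀) :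
    Real.log v ≤ Real.log v₀ + v / v₀ - 1 := by
  have h := Real.log_le_sub_one_of_pos (x := v / v₀) (by positivity)
  rw [Real.log_div hv.ne' hv₀.ne'] at h
  linarith

lemma quadratic_log_lt {u : ℝ} (hu : 10 ≤ u) :
    (u + Real.log (1.128 * u + 0.564)) ^ 2 - (u + Real.log (1.128 * u + 0.564)) - 1 <
      0.9645 * ((1.128 * u + 0.564) * (u + Real.log (1.128 * u + 0.564))) := by
  have hv : 1 < 1.128 * u + 0.564 := by linarith
  have hlv : 0 < Real.log (1.128 * u + 0.564) := Real.log_pos hv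
  have hlog2 := Real.log_two_lt_d9
  suffices h : u + Real.log (1.128 * u + 0.564) <
      0.9645 * (1.128 * u + 0.564) + 1 + 1 / (u + Real.log (1.128 * u + 0.564)) by
    have hL : 0 < u + Real.log (1.128 * u + 0.564) := by linarith
    have h' := mul_lt_mul_of_pos_right h hL
    rw [add_mul _ (1 / _), one_div_mul_cancel hL.ne'] at h'
    linarith
  have hinv {B : ℝ} (hB : u + Real.log (1.128 * u + 0.564) ≤ B) :
      1 / B ≤ 1 / (u + Real.log (1.128 * u + 0.564)) := by
    gcongr
  rcases le_or_gt u 13 with hu' | hu'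
  · have h13 : Real.log 13 ≤ 2.5673 := by
      have h : (13 : ℝ) ^ 27 ≤ 2 ^ 100 := by norm_num
      have h := Real.log_le_log (by norm_num) h
      rw [Real.log_pow, Real.log_pow] at h
      push_cast at h
      linarith
    have h1 := log_le_tangent (v₀ := 13) (by linarith : 0 < 1.128 * u + 0.564) (by norm_num)
    have h2 := hinv (B := 15.75) (by linarith)
    linarith
  · have h16 : Real.log 16 ≤ 2.7726 := by
      rw [show (16 : ℝ) = 2 ^ 4 by norm_num, Real.log_pow]
      push_cast
      linarith
    have h1 := log_le_tangent (v₀ := 16) (by linarith : 0 < 1.128 * u + 0.564) (by norm_num)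
    rcases le_or_gt u 16 with hu'' | hu''
    · have h2 := hinv (B := 19) (by linarith)
      linarith
    · have h2 : 0 < 1 / (u + Real.log (1.128 * u + 0.564)) := by positivity
      linarith

lemma nth_prime_le {n : ℕ} (hn : 26193 ≤ n) :
    (Nat.nth Nat.Prime n : ℝ) ≤ n * (1.128 * Real.log n + 0.564) := by
  have hn' : (26193 : ℝ) ≤ n := by exact_mod_cast hn
  have hn0 : (0 : ℝ) < n := by linarith
  have hu : 10.05 ≤ Real.log n := by
    have h : (2 : ℝ) ^ 29 ≤ 26193 ^ 2 := by norm_num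
    have h := Real.log_le_log (by norm_num) h
    rw [Real.log_pow, Real.log_pow] at h
    have := Real.log_two_gt_d9
    have := Real.log_le_log (by norm_num) hn'
    push_cast at h
    linarith
  by_contra! hlt
  set u := Real.log n
  set v := 1.128 * u + 0.564 with hv
  have hv0 : 11.9 ≤ v := by linarith
  have hx : 302499 ≤ n * v := by nlinarith
  have hL : Real.log (n * v) = u + Real.log v := Real.log_mul hn0.ne' (by linarith)
  have h1 := le_primeCounting hx
  have h2 : Nat.primeCounting ⌊n * v⌋₊ ≤ n := by
    rw [Nat.primeCounting, Nat.primeCounting']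
    exact Nat.le_nth_of_count_le (Nat.succ_le_of_lt ((Nat.floor_lt (by positivity)).2 hlt))
  have h3 : (Nat.primeCounting ⌊n * v⌋₊ : ℝ) ≤ n := by exact_mod_cast h2
  have hlv : 0 < Real.log v := Real.log_pos (by linarith)
  have h4 := quadratic_log_lt (by linarith : 10 ≤ u)
  rw [← hv] at h4
  rw [hL] at h1
  have hD : 0 < (u + Real.log v) ^ 2 - (u + Real.log v) - 1 := by nlinarith
  have h5 : 1 < 0.9645 * (v * (u + Real.log v)) / ((u + Real.log v) ^ 2 - (u + Real.log v) - 1) :=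
    (one_lt_div hD).2 h4
  have h6 := mul_lt_mul_of_pos_left h5 hn0
  have h7 : n * (0.9645 * (v * (u + Real.log v)) / ((u + Real.log v) ^ 2 - (u + Real.log v) - 1)) =
      0.9645 * (n * v * ((u + Real.log v) / ((u + Real.log v) ^ 2 - (u + Real.log v) - 1))) := by
    ring
  linarith

lemma sum_bound_step {n : ℕ} (hn : 1 ≤ n) :
    0.564 * (n : ℝ) ^ 2 * Real.log n + n * (1.128 * Real.log n + 0.564) ≤
      0.564 * ((n + 1 : ℕ) : ℝ) ^ 2 * Real.log (n + 1 : ℕ) := by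
  have hn0 : (1 : ℝ) ≤ n := by exact_mod_cast hn
  have h1 : Real.log n ≤ Real.log (n + 1) - 1 / (n + 1) := by
    have h := log_le_tangent (v := n) (v₀ := n + 1) (by linarith) (by linarith)
    have h' : (n : ℝ) / (n + 1) - 1 = - (1 / (n + 1)) := by field_simp; ring
    linarith
  have h2 := mul_le_mul_of_nonneg_left h1 (by positivity : (0 : ℝ) ≤ 0.564 * (n + 1) ^ 2)
  have h3 : 0.564 * ((n : ℝ) + 1) ^ 2 * (Real.log (n + 1) - 1 / (n + 1)) =
      0.564 * (n + 1) ^ 2 * Real.log (n + 1) - 0.564 * (n + 1) := by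
    field_simp
  have h4 : 0 ≤ Real.log n := Real.log_nonneg hn0
  push_cast
  nlinarith

/-- Lemma 2(iii): For `S ≥ 9`, the sum of the first `S` primes satisfies
`∑_{i=1}^{S} p_i ≤ 0.564 S² log S` (here `Nat.nth Nat.Prime i` is the
`(i+1)`-st prime). -/
theorem sum_primes_upper_bound (S : ℕ) (hS : 9 ≤ S) :
    ∑ i ∈ Finset.range S, (Nat.nth Nat.Prime i : ℝ)
      ≤ 0.564 * (S : ℝ) ^ 2 * Real.log S := by
  rcases le_total S 26193 with h | h
  · exact primeScanInv_302500.bound S hS h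
  · induction S, h using Nat.le_induction with
    | base => exact primeScanInv_302500.bound 26193 hS le_rfl
    | succ n hn ih =>
      rw [Finset.sum_range_succ]
      exact (add_le_add (ih (by omega)) (nth_prime_le hn)).trans (sum_bound_step (by omega))
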